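/- Let L_S = ∏_{p ∈ S_f} L_p, where L_p = p for odd primes p and L_2 = 2³ = 8 (with L_S = 1 if S_f = ∅). There exist r₀ > 1 and C > 0, depending only on L_S, such that for every m₀ ∈ ℕ with gcd(m₀, L_S) = 1 and every real r > r₀ with (r − m₀)/L_S ∉ ℤ: | r·∑_{m ∈ ℕ, m ≥ r, m ≡ m₀ (mod L_S)} φ(m)/m³ − 1/(L_S·ζ_S(2)) | ≤ C·(log r)/r, where φ is Euler's totient function. -/

import Mathlib

open MeasureTheory Matrix

noncomputable section

noncomputable instance Padic.instMeasurableSpace' {p : ℕ} [Fact p.Prime] :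
    MeasurableSpace ℚ_[p] := borel _

instance Padic.instBorelSpace' {p : ℕ} [Fact p.Prime] : BorelSpace ℚ_[p] := ⟨rfl⟩

instance Matrix.SpecialLinearGroup.instTopologicalSpace'
    {n : Type*} [DecidableEq n] [Fintype n] {R : Type*} [CommRing R] [TopologicalSpace R] :
    TopologicalSpace (SpecialLinearGroup n R) :=
  show TopologicalSpace {A : Matrix n n R // A.det = 1} from inferInstance

noncomputable instance Matrix.SpecialLinearGroup.instMeasurableSpace'
    {n : Type*} [DecidableEq n] [Fintype n] {R : Type*} [CommRing R] [TopologicalSpace R] :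
    MeasurableSpace (SpecialLinearGroup n R) := borel _

/-- A finite set of distinct primes `p 0, …, p (s-1)`. -/
structure PrimeTup where
  s : ℕ
  p : Fin s → ℕ
  hp : ∀ i, (p i).Prime
  inj : Function.Injective p

namespace PrimeTup

instance (S : PrimeTup) (i : Fin S.s) : Fact (S.p i).Prime := ⟨S.hp i⟩

/-- The `p i`-adic field. -/
abbrev Qp (S : PrimeTup) (i : Fin S.s) : Type := ℚ_[S.p i]

/-- The space `ℚ_S^d = ℝ^d × ∏ᵢ ℚ_{pᵢ}^d`. -/
abbrev QS (S : PrimeTup) (d : ℕ) : Type :=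
  (Fin d → ℝ) × ((i : Fin S.s) → Fin d → S.Qp i)

/-- The ring `ℤ_S = ℤ[1/p₁, …, 1/p_s] ⊆ ℚ`. -/
def Zs (S : PrimeTup) : Subring ℚ :=
  Subring.closure (Set.range fun i : Fin S.s => ((S.p i : ℚ))⁻¹)

/-- The group `G_d = SL_d(ℝ) × ∏ᵢ SL_d(ℚ_{pᵢ})`. -/
abbrev G (S : PrimeTup) (d : ℕ) : Type :=
  SpecialLinearGroup (Fin d) ℝ × ((i : Fin S.s) → SpecialLinearGroup (Fin d) (S.Qp i))

/-- Diagonal embedding of `SL_d(ℤ_S)` into `G_d`. -/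
def toG (S : PrimeTup) (d : ℕ) : SpecialLinearGroup (Fin d) S.Zs →* S.G d :=
  MonoidHom.prod
    (SpecialLinearGroup.map ((Rat.castHom ℝ).comp S.Zs.subtype))
    (Pi.monoidHom fun i => SpecialLinearGroup.map ((Rat.castHom (S.Qp i)).comp S.Zs.subtype))

/-- The lattice `Γ_d`, the diagonally embedded copy of `SL_d(ℤ_S)` in `G_d`. -/
def Gamma (S : PrimeTup) (d : ℕ) : Subgroup (S.G d) := (S.toG d).range

/-- The componentwise linear action of `G_d` on `ℚ_S^d`. -/
def act (S : PrimeTup) {d : ℕ} (g : S.G d) (x : S.QS d) : S.QS d :=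
  ((g.1 : Matrix (Fin d) (Fin d) ℝ).mulVec x.1,
   fun i => ((g.2 i : Matrix (Fin d) (Fin d) (S.Qp i))).mulVec (x.2 i))

/-- Diagonal embedding of rational vectors into `ℚ_S^d`. -/
def diag (S : PrimeTup) {d : ℕ} (v : Fin d → ℚ) : S.QS d :=
  (fun j => (v j : ℝ), fun i j => (v j : S.Qp i))

/-- The first standard basis vector of `ℤ_S^d`. -/
def e1 (S : PrimeTup) (d : ℕ) : Fin d → S.Zs := fun j => if j.1 = 0 then 1 else 0

/-- The set of `S`-primitive vectors `P(ℤ_S^d) = SL_d(ℤ_S)·e₁` inside `(ℤ_S)^d`. -/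
def primZs (S : PrimeTup) (d : ℕ) : Set (Fin d → S.Zs) :=
  {w | ∃ γ : SpecialLinearGroup (Fin d) S.Zs,
    w = (γ : Matrix (Fin d) (Fin d) S.Zs).mulVec (S.e1 d)}

/-- The set of `S`-primitive vectors regarded inside `ℚ_S^d` via the diagonal embedding. -/
def prim (S : PrimeTup) (d : ℕ) : Set (S.QS d) :=
  (fun w : Fin d → S.Zs => S.diag fun j => ((w j : ℚ))) '' S.primZs d

/-- Multiplication of a vector of `ℚ_S^d` by a (diagonally embedded) rational scalar. -/
def ratSMul (S : PrimeTup) {d : ℕ} (q : ℚ) (x : S.QS d) : S.QS d :=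
  (fun j => (q : ℝ) * x.1 j, fun i j => (q : S.Qp i) * x.2 i j)

/-- `ℕ_S`: positive integers coprime to all the primes of `S`. -/
def NS (S : PrimeTup) : Set ℕ := {m | 0 < m ∧ ∀ i, ¬ (S.p i ∣ m)}

/-- The `S`-arithmetic zeta value `ζ_S(d)`. -/
def zetaS (S : PrimeTup) (d : ℕ) : ℝ := ∑' m : S.NS, (1 : ℝ) / ((m : ℕ) : ℝ) ^ d

/-- The "unit box" `[0,1]^d × ∏ᵢ ℤ_{pᵢ}^d` used to normalize the volume on `ℚ_S^d`. -/
def unitBox (S : PrimeTup) (d : ℕ) : Set (S.QS d) :=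
  {x | (∀ j, x.1 j ∈ Set.Icc (0:ℝ) 1) ∧ ∀ i j, ‖x.2 i j‖ ≤ 1}

/-- `v` is the measure `vol_S` on `ℚ_S^d`: the (unique) translation-invariant regular Borel
measure giving the unit box `[0,1]^d × ∏ᵢ ℤ_{pᵢ}^d` measure one; equivalently, the product of
Lebesgue measure on `ℝ^d` and the normalized Haar measures on the `ℚ_{pᵢ}^d`. -/
def IsVolS (S : PrimeTup) (d : ℕ) (v : Measure (S.QS d)) : Prop :=
  v.IsAddHaarMeasure ∧ v.Regular ∧ v (S.unitBox d) = 1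

/-- `μ` is an admissible measure on `G_d/Γ_d`: a regular Borel probability measure invariant
under the left `G_d`-action. -/
def Admissible (S : PrimeTup) (d : ℕ) (μ : Measure (S.G d ⧸ S.Gamma d)) : Prop :=
  IsProbabilityMeasure μ ∧ μ.Regular ∧ SMulInvariantMeasure (S.G d) (S.G d ⧸ S.Gamma d) μ

end PrimeTup

end

namespace PrimeTup

/-- `L_S = ∏_{p ∈ S_f} L_p` with `L_p = p` for odd `p` and `L_2 = 8`. -/
def LS (S : PrimeTup) : ℕ := ∏ i, (if S.p i = 2 then 8 else S.p i)

end PrimeTup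

section TotientTail

open Filter Topology Finset
open scoped ArithmeticFunction.Moebius

theorem Nat.tsum_mul_eq_tsum_sum_divisorsAntidiagonal {F : ℕ × ℕ → ℝ} (hF : Summable F)
    (h₁ : ∀ k, F (0, k) = 0) (h₂ : ∀ d, F (d, 0) = 0) :
    ∑' p, F p = ∑' m : ℕ, ∑ p ∈ m.divisorsAntidiagonal, F p := by
  rw [← (hF.hasSum.tsum_fiberwise fun p : ℕ × ℕ => p.1 * p.2).tsum_eq]
  refine tsum_congr fun m => ?_
  rw [tsum_subtype ((fun p : ℕ × ℕ => p.1 * p.2) ⁻¹' {m}) F, tsum_eq_sum]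
  · refine sum_congr rfl fun p hp => ?_
    rw [Set.indicator_of_mem]
    exact (Nat.mem_divisorsAntidiagonal.1 hp).1
  · rintro ⟨d, k⟩ hp
    by_cases hm : d * k = m
    · rw [Set.indicator_of_mem (show (d, k) ∈ _ from hm)]
      have h0 : m = 0 := by
        by_contra h
        exact hp (Nat.mem_divisorsAntidiagonal.2 ⟨hm, h⟩)
      rcases Nat.mul_eq_zero.1 (hm.trans h0) with rfl | rfl
      · exact h₁ k
      · exact h₂ d
    · exact Set.indicator_of_notMem (by simpa using hm) _

theorem Nat.sum_moebius_div_eq_totient_div (m : ℕ) :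
    ∑ p ∈ m.divisorsAntidiagonal, (μ p.1 : ℝ) / p.1 = (Nat.totient m : ℝ) / m := by
  rcases Nat.eq_zero_or_pos m with rfl | hm
  · simp
  have h := (ArithmeticFunction.sum_eq_iff_sum_mul_moebius_eq (R := ℝ)
    (f := fun n => (Nat.totient n : ℝ)) (g := fun n => (n : ℝ))).1
    (fun n _ => by exact_mod_cast Nat.sum_totient n) m hm
  have hm' : (m : ℝ) ≠ 0 := by positivity
  rw [eq_div_iff hm', ← h, sum_mul]
  refine sum_congr rfl fun p hp => ?_
  obtain ⟨hp, -⟩ := Nat.mem_divisorsAntidiagonal.1 hp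
  have h1 : (p.1 : ℝ) ≠ 0 := by
    rintro h0
    rw [Nat.cast_eq_zero] at h0
    rw [h0, zero_mul] at hp
    omega
  rw [← hp]
  push_cast
  field_simp

theorem hasSum_inv_sub_inv_add_mul {x L : ℝ} (hx : 0 < x) (hL : 0 < L) :
    HasSum (fun j : ℕ => 1 / (x + j * L) - 1 / (x + (j + 1) * L)) (1 / x) := by
  rw [hasSum_iff_tendsto_nat_of_nonneg]
  · have h : ∀ n : ℕ, ∑ j ∈ range n, (1 / (x + j * L) - 1 / (x + (j + 1) * L)) =
        1 / x - 1 / (x + n * L) := fun n => by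
      have := sum_range_sub' (fun j : ℕ => 1 / (x + j * L)) n
      simpa using this
    simp_rw [h]
    have : Tendsto (fun n : ℕ => 1 / (x + n * L)) atTop (𝓝 0) := by
      simp_rw [one_div]
      exact tendsto_inv_atTop_zero.comp
        (tendsto_atTop_add_const_left _ _ (tendsto_natCast_atTop_atTop.atTop_mul_const hL))
    simpa using tendsto_const_nhds.sub this
  · intro j
    rw [sub_nonneg]
    gcongr
    linarith

theorem summable_and_bounds_tsum_inv_sq_arith {x L : ℝ} (hx : 0 < x) (hL : 0 < L) :
    Summable (fun j : ℕ => 1 / (x + j * L) ^ 2) ∧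
      1 / (L * x) ≤ ∑' j : ℕ, 1 / (x + j * L) ^ 2 ∧
      ∑' j : ℕ, 1 / (x + j * L) ^ 2 ≤ 1 / x ^ 2 + 1 / (L * x) := by
  have ht := (hasSum_inv_sub_inv_add_mul hx hL).mul_left (1 / L)
  have hlow : ∀ j : ℕ, 1 / L * (1 / (x + j * L) - 1 / (x + (j + 1) * L)) ≤
      1 / (x + j * L) ^ 2 := fun j => by
    have h1 : 0 < x + j * L := by positivity
    have h2 : 0 < x + (j + 1) * L := by positivity
    have : 1 / L * (1 / (x + j * L) - 1 / (x + (j + 1) * L)) =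
        1 / ((x + j * L) * (x + (j + 1) * L)) := by
      field_simp
      ring
    rw [this, sq]
    gcongr
    linarith
  have hup : ∀ j : ℕ, 1 / (x + (j + 1 : ℕ) * L) ^ 2 ≤
      1 / L * (1 / (x + j * L) - 1 / (x + (j + 1) * L)) := fun j => by
    have h1 : 0 < x + j * L := by positivity
    have h2 : 0 < x + (j + 1) * L := by positivity
    have : 1 / L * (1 / (x + j * L) - 1 / (x + (j + 1) * L)) =
        1 / ((x + j * L) * (x + (j + 1) * L)) := by
      field_simp
      ring
    rw [this, sq]
    push_cast
    gcongr
    linarith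
  have hs' : Summable (fun j : ℕ => 1 / (x + (j + 1 : ℕ) * L) ^ 2) :=
    Summable.of_nonneg_of_le (fun j => by positivity) hup ht.summable
  have hs : Summable (fun j : ℕ => 1 / (x + j * L) ^ 2) :=
    (summable_nat_add_iff (f := fun j : ℕ => 1 / (x + j * L) ^ 2) 1).1 hs'
  have e : 1 / L * (1 / x) = 1 / (L * x) := by field_simp
  refine ⟨hs, ?_, ?_⟩
  · rw [← e, ← ht.tsum_eq]
    exact ht.summable.tsum_le_tsum hlow hs
  · rw [hs.tsum_eq_zero_add, ← e, ← ht.tsum_eq]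
    have := hs'.tsum_le_tsum hup ht.summable
    simp only [Nat.cast_zero, zero_mul, add_zero]
    linarith

open Classical in
theorem abs_tsum_inv_sq_residue_sub_le {ρ : ℝ} (hρ : 0 < ρ) {L : ℕ} (hL : 0 < L) (a : ℕ) :
    |(∑' k : ℕ, if ρ ≤ (k : ℝ) ∧ k ≡ a [MOD L] then 1 / (k : ℝ) ^ 2 else 0) - 1 / (L * ρ)| ≤
      2 * min (1 / ρ ^ 2) (1 / ρ) := by
  have hLR : (1 : ℝ) ≤ L := by exact_mod_cast hL
  have hex : ∃ k : ℕ, ρ ≤ (k : ℝ) ∧ k ≡ a [MOD L] := by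
    refine ⟨a + L * ⌈ρ⌉₊, ?_, by simp [Nat.ModEq]⟩
    have h1 := Nat.le_ceil ρ
    have h2 : ⌈ρ⌉₊ ≤ a + L * ⌈ρ⌉₊ := by nlinarith
    exact h1.trans (by exact_mod_cast h2)
  obtain ⟨k₁, ⟨hk₁, hm₁⟩, hmin⟩ : ∃ k₁ : ℕ, (ρ ≤ (k₁ : ℝ) ∧ k₁ ≡ a [MOD L]) ∧
      ∀ k : ℕ, (ρ ≤ (k : ℝ) ∧ k ≡ a [MOD L]) → k₁ ≤ k :=
    ⟨Nat.find hex, Nat.find_spec hex, fun k hk => Nat.find_min' hex hk⟩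
  have hk0 : 0 < k₁ := by exact_mod_cast hρ.trans_le hk₁
  have hk1R : (1 : ℝ) ≤ k₁ := by exact_mod_cast hk0
  have hlt : (k₁ : ℝ) < ρ + L := by
    by_contra! h
    have hle : L ≤ k₁ := by
      have : (L : ℝ) ≤ k₁ := by linarith
      exact_mod_cast this
    have := hmin (k₁ - L) ⟨by rw [Nat.cast_sub hle]; linarith, by
      refine Nat.ModEq.trans ?_ hm₁
      have h' : k₁ - L + L ≡ k₁ [MOD L] := by rw [Nat.sub_add_cancel hle]
      simpa [Nat.ModEq] using h'⟩
    omega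
  have hinj : Function.Injective fun j : ℕ => k₁ + j * L := fun i j h => by
    simpa [hL.ne'] using h
  have hT : (∑' k : ℕ, if ρ ≤ (k : ℝ) ∧ k ≡ a [MOD L] then 1 / (k : ℝ) ^ 2 else 0) =
      ∑' j : ℕ, 1 / ((k₁ : ℝ) + j * L) ^ 2 := by
    rw [← hinj.tsum_eq]
    · refine tsum_congr fun j => ?_
      rw [if_pos]
      · push_cast
        rfl
      · refine ⟨hk₁.trans ?_, ?_⟩
        · push_cast
          nlinarith [(Nat.cast_nonneg j : (0 : ℝ) ≤ j)]
        · refine Nat.ModEq.trans ?_ hm₁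
          simp [Nat.ModEq]
    · intro k hk
      rw [Function.mem_support, ne_eq, ite_eq_right_iff, Classical.not_imp] at hk
      have hle := hmin k hk.1
      obtain ⟨j, hj⟩ := (Nat.modEq_iff_dvd' hle).1 (hm₁.trans hk.1.2.symm)
      refine ⟨j, ?_⟩
      simp only
      rw [mul_comm, ← hj]
      omega
  obtain ⟨-, hlo, hhi⟩ := summable_and_bounds_tsum_inv_sq_arith
    (show (0 : ℝ) < k₁ by linarith) (show (0 : ℝ) < L by linarith)
  rw [hT]
  set T := ∑' j : ℕ, 1 / ((k₁ : ℝ) + j * L) ^ 2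
  have h1 : T - 1 / (L * ρ) ≤ 1 / (k₁ : ℝ) ^ 2 := by
    have : 1 / ((L : ℝ) * k₁) ≤ 1 / (L * ρ) := by gcongr
    linarith
  have h2 : 1 / (k₁ : ℝ) ^ 2 ≤ 1 / ρ ^ 2 := by gcongr
  have h3 : -(1 / ρ ^ 2) ≤ T - 1 / (L * ρ) := by
    have h4 : 1 / ((L : ℝ) * (ρ + L)) ≤ 1 / (L * k₁) := by gcongr
    have h5 : 1 / (L * ρ) - 1 / ((L : ℝ) * (ρ + L)) = 1 / (ρ * (ρ + L)) := by
      field_simp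
      ring
    have h6 : 1 / (ρ * (ρ + L)) ≤ 1 / ρ ^ 2 := by
      rw [sq]
      gcongr
      linarith
    linarith
  have h7 : 1 / (k₁ : ℝ) ^ 2 ≤ 1 := by
    rw [div_le_one (by positivity)]
    nlinarith
  have h8 : 1 / ((L : ℝ) * k₁) ≤ 1 := by
    rw [div_le_one (by positivity)]
    nlinarith
  have h9 : 1 / ((L : ℝ) * ρ) ≤ 1 / ρ := by
    gcongr
    nlinarith
  have h10 : 0 ≤ 1 / ((L : ℝ) * k₁) := by positivity
  rw [mul_min_of_nonneg _ _ zero_le_two, le_min_iff]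
  have hsq : 0 < 1 / ρ ^ 2 := by positivity
  have hiv : 0 < 1 / ρ := by positivity
  constructor
  · rw [abs_le]
    constructor <;> linarith
  · rcases le_total ρ 1 with h | h
    · have : 1 ≤ 1 / ρ := by rw [le_div_iff₀ hρ]; linarith
      have h11 : 0 ≤ 1 / ((L : ℝ) * ρ) := by positivity
      rw [abs_le]
      constructor <;> linarith
    · have : 1 / ρ ^ 2 ≤ 1 / ρ := by
        gcongr
        nlinarith
      rw [abs_le]
      constructor <;> linarith

theorem summable_and_tsum_min_inv_le {r : ℝ} (hr : 1 ≤ r) :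
    Summable (fun d : ℕ => min (1 / (d * r)) (1 / (d : ℝ) ^ 2)) ∧
      ∑' d : ℕ, min (1 / (d * r)) (1 / (d : ℝ) ^ 2) ≤ (3 + Real.log r) / r := by
  have hr0 : 0 < r := by linarith
  have hnn : ∀ d : ℕ, 0 ≤ min (1 / (d * r)) (1 / (d : ℝ) ^ 2) := fun d => by positivity
  have hsum : ∀ n : ℕ, ∑ d ∈ range n, min (1 / (d * r)) (1 / (d : ℝ) ^ 2) ≤
      (3 + Real.log r) / r := fun n => by
    have hsub : range n ⊆ {0} ∪ (Icc 1 ⌊r⌋₊ ∪ Ioo ⌊r⌋₊ n) := fun d hd => by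
      simp only [mem_range, mem_union, mem_singleton, mem_Icc, mem_Ioo] at hd ⊢
      omega
    have h1 : ∑ d ∈ Icc 1 ⌊r⌋₊, min (1 / (d * r)) (1 / (d : ℝ) ^ 2) ≤ (1 + Real.log r) / r := by
      have := harmonic_floor_le_one_add_log r hr
      rw [harmonic_eq_sum_Icc] at this
      push_cast at this
      calc _ ≤ ∑ d ∈ Icc 1 ⌊r⌋₊, (d : ℝ)⁻¹ / r := sum_le_sum fun d _ =>
              (min_le_left _ _).trans_eq (by rw [one_div, mul_inv, div_eq_mul_inv])
        _ = (∑ d ∈ Icc 1 ⌊r⌋₊, (d : ℝ)⁻¹) / r := by rw [sum_div]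
        _ ≤ _ := by gcongr
    have h2 : ∑ d ∈ Ioo ⌊r⌋₊ n, min (1 / (d * r)) (1 / (d : ℝ) ^ 2) ≤ 2 / r := by
      calc _ ≤ ∑ d ∈ Ioo ⌊r⌋₊ n, ((d : ℝ) ^ 2)⁻¹ := sum_le_sum fun d _ =>
              (min_le_right _ _).trans_eq (one_div _)
        _ ≤ 2 / ((⌊r⌋₊ : ℝ) + 1) := sum_Ioo_inv_sq_le _ _
        _ ≤ _ := by
          gcongr
          exact (Nat.lt_floor_add_one r).le
    calc _ ≤ ∑ d ∈ {0} ∪ (Icc 1 ⌊r⌋₊ ∪ Ioo ⌊r⌋₊ n), min (1 / (d * r)) (1 / (d : ℝ) ^ 2) :=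
          sum_le_sum_of_subset_of_nonneg hsub fun d _ _ => hnn d
      _ ≤ ∑ d ∈ {0}, min (1 / ((d : ℕ) * r)) (1 / ((d : ℕ) : ℝ) ^ 2) +
          ∑ d ∈ Icc 1 ⌊r⌋₊ ∪ Ioo ⌊r⌋₊ n, min (1 / (d * r)) (1 / (d : ℝ) ^ 2) := by
        rw [← sum_union_inter]
        exact le_add_of_nonneg_right (sum_nonneg fun d _ => hnn d)
      _ ≤ 0 + ((1 + Real.log r) / r + 2 / r) := by
        gcongr
        · simp
        · refine le_trans ?_ (add_le_add h1 h2)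
          rw [← sum_union_inter]
          exact le_add_of_nonneg_right (sum_nonneg fun d _ => hnn d)
      _ = _ := by ring
  exact ⟨summable_of_sum_range_le hnn hsum, Real.tsum_le_of_sum_range_le hnn hsum⟩

theorem tsum_coprime_mul_tsum_moebius_eq_one (L : ℕ) :
    (∑' n : ℕ, if n.Coprime L then 1 / (n : ℝ) ^ 2 else 0) *
      (∑' n : ℕ, if n.Coprime L then (μ n : ℝ) / (n : ℝ) ^ 2 else 0) = 1 := by
  have h := DirichletCharacter.LSeries.mul_mu_eq_one (1 : DirichletCharacter ℂ L)
    (s := 2) (by norm_num)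
  have hχ : ∀ n : ℕ, (1 : DirichletCharacter ℂ L) (n : ZMod L) =
      if n.Coprime L then 1 else 0 := fun n => by
    split_ifs with hn
    · exact MulChar.one_apply ((ZMod.isUnit_iff_coprime n L).2 hn)
    · exact MulChar.map_nonunit _ (mt (ZMod.isUnit_iff_coprime n L).1 hn)
  rw [← Complex.ofReal_inj, Complex.ofReal_mul, Complex.ofReal_tsum, Complex.ofReal_tsum,
    Complex.ofReal_one, ← h]
  unfold LSeries
  congr 1
  · refine tsum_congr fun n => ?_
    rcases eq_or_ne n 0 with rfl | hn
    · simp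
    rw [LSeries.term_of_ne_zero hn, hχ]
    split_ifs <;> simp
  · refine tsum_congr fun n => ?_
    rcases eq_or_ne n 0 with rfl | hn
    · simp
    rw [LSeries.term_of_ne_zero hn, Pi.mul_apply, hχ]
    split_ifs <;> simp

theorem PrimeTup.coprime_LS_iff (S : PrimeTup) (m : ℕ) :
    m.Coprime S.LS ↔ ∀ i, ¬ S.p i ∣ m := by
  unfold PrimeTup.LS
  rw [Nat.coprime_prod_right_iff]
  refine forall_congr' fun i => ?_
  simp only [mem_univ, true_implies]
  rw [← (S.hp i).coprime_iff_not_dvd, Nat.coprime_comm]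
  split_ifs with h
  · rw [h, show 8 = 2 ^ 3 by norm_num, Nat.coprime_pow_left_iff (by norm_num)]
  · rfl

theorem PrimeTup.LS_pos (S : PrimeTup) : 0 < S.LS :=
  prod_pos fun i _ => by
    split_ifs
    · norm_num
    · exact (S.hp i).pos

theorem PrimeTup.zetaS_two_eq (S : PrimeTup) :
    S.zetaS 2 = ∑' n : ℕ, if n.Coprime S.LS then 1 / (n : ℝ) ^ 2 else 0 := by
  unfold PrimeTup.zetaS
  rw [tsum_subtype S.NS fun n : ℕ => (1 : ℝ) / (n : ℝ) ^ 2]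
  refine tsum_congr fun n => ?_
  rcases eq_or_ne n 0 with rfl | hn
  · simp
  · simp [Set.indicator_apply, PrimeTup.NS, S.coprime_LS_iff, Nat.pos_of_ne_zero hn]

open Classical in
theorem tsum_inv_sq_residue_mul_of_coprime {L m₀ d : ℕ} (hL : 0 < L) (hd : 0 < d)
    (hdL : d.Coprime L) {r : ℝ} (hr : 0 < r) :
    |(∑' k : ℕ, if r ≤ ((d * k : ℕ) : ℝ) ∧ d * k ≡ m₀ [MOD L] then
        1 / ((d * k : ℕ) : ℝ) ^ 2 else 0) - 1 / (L * d * r)| ≤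
      2 * min (1 / r ^ 2) (1 / (d * r)) := by
  have hdR : (0 : ℝ) < d := by exact_mod_cast hd
  obtain ⟨a, ha⟩ : ∃ a, d * a ≡ m₀ [MOD L] := by
    obtain ⟨a, -, ha⟩ := Nat.exists_mul_mod_eq_of_coprime m₀ hdL hL.ne'
    exact ⟨a, ha⟩
  have hiff : ∀ k : ℕ, (r ≤ ((d * k : ℕ) : ℝ) ∧ d * k ≡ m₀ [MOD L]) ↔
      (r / d ≤ (k : ℝ) ∧ k ≡ a [MOD L]) := fun k => by
    refine and_congr ?_ ⟨fun h => ?_, fun h => (h.mul_left d).trans ha⟩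
    · rw [div_le_iff₀ hdR, Nat.cast_mul, mul_comm]
    · exact Nat.ModEq.cancel_left_of_coprime hdL.symm (h.trans ha.symm)
  have e : (∑' k : ℕ, if r ≤ ((d * k : ℕ) : ℝ) ∧ d * k ≡ m₀ [MOD L] then
        1 / ((d * k : ℕ) : ℝ) ^ 2 else 0) = 1 / (d : ℝ) ^ 2 *
      ∑' k : ℕ, if r / d ≤ (k : ℝ) ∧ k ≡ a [MOD L] then 1 / (k : ℝ) ^ 2 else 0 := by
    rw [← tsum_mul_left]
    refine tsum_congr fun k => ?_
    simp only [hiff, mul_ite, mul_zero]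
    split_ifs
    · push_cast
      rw [mul_pow, one_div_mul_one_div]
    · rfl
  have h := abs_tsum_inv_sq_residue_sub_le (div_pos hr hdR) hL a
  have hd2 : (0 : ℝ) < 1 / (d : ℝ) ^ 2 := by positivity
  have e2 : 1 / ((L : ℝ) * d * r) = 1 / (d : ℝ) ^ 2 * (1 / (L * (r / d))) := by
    field_simp
  rw [e, e2, ← mul_sub, abs_mul, abs_of_pos hd2]
  refine (mul_le_mul_of_nonneg_left h hd2.le).trans_eq ?_
  rw [mul_left_comm, mul_min_of_nonneg _ _ hd2.le]
  congr 2 <;> field_simp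

open Classical in
theorem tsum_totient_residue_eq {L m₀ : ℕ} {r : ℝ} :
    let w : ℕ → ℝ := fun m => if r ≤ (m : ℝ) ∧ m ≡ m₀ [MOD L] then 1 / (m : ℝ) ^ 2 else 0
    Summable (fun d : ℕ => (μ d : ℝ) / d * ∑' k : ℕ, w (d * k)) ∧
    (∑' m : {m : ℕ // r ≤ (m : ℝ) ∧ m % L = m₀ % L},
        (Nat.totient (m : ℕ) : ℝ) / ((m : ℕ) : ℝ) ^ 3) =
      ∑' d : ℕ, (μ d : ℝ) / d * ∑' k : ℕ, w (d * k) := by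
  intro w
  have hw0 : w 0 = 0 := by simp [w]
  have hw : ∀ m, |w m| ≤ 1 / (m : ℝ) ^ 2 := fun m => by
    simp only [w]
    split_ifs
    · rw [abs_of_nonneg (by positivity)]
    · rw [abs_zero]
      positivity
  have hμ : ∀ d : ℕ, |(μ d : ℝ)| ≤ 1 := fun d => by
    exact_mod_cast ArithmeticFunction.abs_moebius_le_one (n := d)
  set F : ℕ × ℕ → ℝ := fun p => (μ p.1 : ℝ) / p.1 * w (p.1 * p.2) with hFdef
  have hF : Summable F := by
    have hG : Summable fun p : ℕ × ℕ => 1 / (p.1 : ℝ) ^ 3 * (1 / (p.2 : ℝ) ^ 2) :=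
      (Real.summable_one_div_nat_pow.2 (by norm_num)).mul_of_nonneg
        (Real.summable_one_div_nat_pow.2 (by norm_num))
        (fun _ => by positivity) (fun _ => by positivity)
    refine Summable.of_norm_bounded hG fun p => ?_
    rw [hFdef, Real.norm_eq_abs, abs_mul, abs_div, Nat.abs_cast]
    calc _ ≤ 1 / (p.1 : ℝ) * (1 / ((p.1 * p.2 : ℕ) : ℝ) ^ 2) := by
          gcongr
          · exact hμ _
          · exact hw _
      _ = _ := by
        push_cast
        rw [mul_pow, one_div_mul_one_div, one_div_mul_one_div]
        ring
  have hsub : (∑' m : {m : ℕ // r ≤ (m : ℝ) ∧ m % L = m₀ % L},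
      (Nat.totient (m : ℕ) : ℝ) / ((m : ℕ) : ℝ) ^ 3) =
      ∑' m : ℕ, (Nat.totient m : ℝ) / m * w m := by
    refine (tsum_subtype {m : ℕ | r ≤ (m : ℝ) ∧ m % L = m₀ % L}
      fun m : ℕ => (Nat.totient m : ℝ) / (m : ℝ) ^ 3).trans (tsum_congr fun m => ?_)
    by_cases hm : m ∈ {m : ℕ | r ≤ (m : ℝ) ∧ m % L = m₀ % L}
    · rw [Set.indicator_of_mem hm, show w m = 1 / (m : ℝ) ^ 2 from if_pos hm, div_mul_div_comm,
        mul_one, ← pow_succ']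
    · rw [Set.indicator_of_notMem hm, show w m = 0 from if_neg hm, mul_zero]
  have hfib := Nat.tsum_mul_eq_tsum_sum_divisorsAntidiagonal hF (by simp [F]) (by simp [F, hw0])
  have hdiv : ∀ m : ℕ, ∑ p ∈ m.divisorsAntidiagonal, F p = (Nat.totient m : ℝ) / m * w m :=
    fun m => by
      rw [← Nat.sum_moebius_div_eq_totient_div, sum_mul]
      refine sum_congr rfl fun p hp => ?_
      rw [← (Nat.mem_divisorsAntidiagonal.1 hp).1]
  have hmul : ∀ d : ℕ, ∑' k : ℕ, F (d, k) = (μ d : ℝ) / d * ∑' k : ℕ, w (d * k) :=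
    fun d => by simp only [hFdef, tsum_mul_left]
  constructor
  · simpa only [hmul] using hF.prod
  · rw [hsub]
    simp_rw [← hdiv]
    rw [← hfib, hF.tsum_prod]
    exact tsum_congr hmul

theorem abs_mul_tsum_totient_residue_sub_le {L m₀ : ℕ} (hL : 0 < L) (hm₀ : m₀.Coprime L) {r : ℝ}
    (hr : 1 ≤ r) :
    |r * (∑' m : {m : ℕ // r ≤ (m : ℝ) ∧ m % L = m₀ % L},
        (Nat.totient (m : ℕ) : ℝ) / ((m : ℕ) : ℝ) ^ 3) -
      1 / L * ∑' n : ℕ, if n.Coprime L then (μ n : ℝ) / (n : ℝ) ^ 2 else 0| ≤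
      2 * ((3 + Real.log r) / r) := by
  classical
  have hr0 : 0 < r := by linarith
  obtain ⟨hs, he⟩ := tsum_totient_residue_eq (L := L) (m₀ := m₀) (r := r)
  have hμ : ∀ d : ℕ, |(μ d : ℝ)| ≤ 1 := fun d => by
    exact_mod_cast ArithmeticFunction.abs_moebius_le_one (n := d)
  have hsμ : Summable fun n : ℕ => if n.Coprime L then (μ n : ℝ) / (n : ℝ) ^ 2 else 0 := by
    refine Summable.of_norm_bounded
      (Real.summable_one_div_nat_pow.2 (one_lt_two)) fun n => ?_
    split_ifs
    · rw [Real.norm_eq_abs, abs_div, abs_of_nonneg (by positivity : (0 : ℝ) ≤ (n : ℝ) ^ 2)]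
      gcongr
      exact hμ n
    · rw [norm_zero]
      positivity
  obtain ⟨hsm, hle⟩ := summable_and_tsum_min_inv_le hr
  rw [he, ← tsum_mul_left, ← tsum_mul_left, ← (hs.mul_left r).tsum_sub (hsμ.mul_left _),
    ← Real.norm_eq_abs]
  refine (tsum_of_norm_bounded (hsm.mul_left 2).hasSum fun d => ?_).trans ?_
  · rcases Nat.eq_zero_or_pos d with rfl | hd
    · simp
    have hdR : (0 : ℝ) < d := by exact_mod_cast hd
    split_ifs with hdL
    · have h := tsum_inv_sq_residue_mul_of_coprime (m₀ := m₀) hL hd hdL hr0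
      set T := ∑' k : ℕ, if r ≤ ((d * k : ℕ) : ℝ) ∧ d * k ≡ m₀ [MOD L] then
        1 / ((d * k : ℕ) : ℝ) ^ 2 else 0
      have e : r * ((μ d : ℝ) / d * T) - 1 / L * ((μ d : ℝ) / (d : ℝ) ^ 2) =
          (μ d : ℝ) * (r / d * (T - 1 / (L * d * r))) := by
        field_simp
      have hrd : 0 < r / d := by positivity
      rw [e, Real.norm_eq_abs, abs_mul, abs_mul, abs_of_pos hrd]
      calc _ ≤ 1 * (r / d * (2 * min (1 / r ^ 2) (1 / (d * r)))) := by
            gcongr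
            exact hμ d
        _ = 2 * (r / d * min (1 / r ^ 2) (1 / (d * r))) := by ring
        _ = _ := by
          rw [mul_min_of_nonneg _ _ hrd.le]
          congr 2 <;> field_simp
    · have h0 : ∀ k : ℕ, ¬ (r ≤ ((d * k : ℕ) : ℝ) ∧ d * k ≡ m₀ [MOD L]) := fun k hk => by
        refine hdL (Nat.Coprime.coprime_mul_right (k := k) ?_)
        rw [Nat.Coprime, hk.2.gcd_eq]
        exact hm₀
      simp only [h0, if_false, tsum_zero, mul_zero, sub_zero, norm_zero]
      positivity
  · rw [tsum_mul_left]
    gcongr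

end TotientTail

open PrimeTup in
/-- **Asymptotics of the weighted totient tail sum** (Corollary 4.3).  There are
`r₀ > 1` and `C > 0`, depending only on `L_S`, such that for every `m₀` coprime to
`L_S` and every real `r > r₀` with `(r − m₀)/L_S ∉ ℤ`,
`| r·∑_{m ≥ r, m ≡ m₀ (mod L_S)} φ(m)/m³ − 1/(L_S ζ_S(2)) | ≤ C (log r)/r`. -/
theorem totient_tail_sum_asymptotic (S : PrimeTup) :
    ∃ r₀ : ℝ, 1 < r₀ ∧ ∃ C : ℝ, 0 < C ∧
      ∀ m₀ : ℕ, Nat.gcd m₀ S.LS = 1 →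
        ∀ r : ℝ, r₀ < r → (∀ z : ℤ, (r - (m₀ : ℝ)) / (S.LS : ℝ) ≠ (z : ℝ)) →
          |r * (∑' m : {m : ℕ // r ≤ (m : ℝ) ∧ m % S.LS = m₀ % S.LS},
              (Nat.totient (m : ℕ) : ℝ) / ((m : ℕ) : ℝ) ^ 3) -
            1 / ((S.LS : ℝ) * S.zetaS 2)| ≤ C * Real.log r / r := by
  refine ⟨3, by norm_num, 8, by norm_num, fun m₀ hm₀ r hr _ => ?_⟩
  have hlog : 1 ≤ Real.log r := by
    rw [Real.le_log_iff_exp_le (by linarith)]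
    linarith [Real.exp_one_lt_d9]
  have hζ := tsum_coprime_mul_tsum_moebius_eq_one S.LS
  rw [← S.zetaS_two_eq] at hζ
  have h := abs_mul_tsum_totient_residue_sub_le S.LS_pos hm₀ (show 1 ≤ r by linarith)
  rw [eq_one_div_of_mul_eq_one_right hζ, one_div_mul_one_div] at h
  refine h.trans ?_
  rw [← mul_div_assoc]
  refine div_le_div_of_nonneg_right ?_ (by linarith)
  linarith
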